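/- Let Φ be an Orlicz function and let p, q be reals with 1 ≤ p < p_Φ ≤ q_Φ < q < ∞, where p_Φ, q_Φ are the Matuzewska–Orlicz indices of Φ. Then there exists a constant C, depending only on Φ, p and q, such that for every measurable function f on (0,∞) with ∫₀^∞ Φ(|f(t)|) dt < ∞, one has ∫₀^∞ Φ(|S_{p,q}f(t)|) dt ≤ C ∫₀^∞ Φ(|f(t)|) dt. -/

import Mathlib

open MeasureTheory Filter Set

/-- An Orlicz function: continuous, increasing and convex on `[0,∞)`, vanishing at `0`,
and tending to `∞` at `∞`. -/
structure IsOrliczFunction (Φ : ℝ → ℝ) : Prop where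
  map_zero : Φ 0 = 0
  continuousOn : ContinuousOn Φ (Set.Ici 0)
  monotoneOn : MonotoneOn Φ (Set.Ici 0)
  convexOn : ConvexOn ℝ (Set.Ici 0) Φ
  tendsto_atTop : Filter.Tendsto Φ Filter.atTop Filter.atTop

/-- The `Δ₂`-condition: `Φ(2t) ≤ C Φ(t)` for all `t ≥ 0` and some constant `C > 0`. -/
def Delta2 (Φ : ℝ → ℝ) : Prop :=
  ∃ C : ℝ, 0 < C ∧ ∀ t : ℝ, 0 ≤ t → Φ (2 * t) ≤ C * Φ t

/-- `M(t,Φ) = sup_{s>0} Φ(ts)/Φ(s)`. -/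
noncomputable def orliczM (Φ : ℝ → ℝ) (t : ℝ) : ℝ :=
  sSup {r : ℝ | ∃ s : ℝ, 0 < s ∧ r = Φ (t * s) / Φ s}

/-- `p` and `q` are the Matuzewska–Orlicz indices of `Φ`:
`p = lim_{t→0⁺} log M(t,Φ)/log t` and `q = lim_{t→∞} log M(t,Φ)/log t`. -/
def HasMatuzewskaOrliczIndices (Φ : ℝ → ℝ) (p q : ℝ) : Prop :=
  Filter.Tendsto (fun t : ℝ => Real.log (orliczM Φ t) / Real.log t)
      (nhdsWithin 0 (Set.Ioi 0)) (nhds p) ∧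
  Filter.Tendsto (fun t : ℝ => Real.log (orliczM Φ t) / Real.log t)
      Filter.atTop (nhds q)

/-- The Calderón operator
`S_{p,q} f(t) = t^{-1/p} ∫₀^t s^{1/p} f(s) ds/s + t^{-1/q} ∫_t^∞ s^{1/q} f(s) ds/s`. -/
noncomputable def Spq (p q : ℝ) (f : ℝ → ℝ) (t : ℝ) : ℝ :=
  t ^ (-(1/p)) * (∫ s in (0:ℝ)..t, s ^ (1/p) * f s / s) +
    t ^ (-(1/q)) * ∫ s in Set.Ioi t, s ^ (1/q) * f s / s

noncomputable def pw (a b u : ℝ) : ℝ := if u ≤ 1 then u ^ a else u ^ b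

lemma pw_pos (a b : ℝ) {u : ℝ} (hu : 0 < u) : 0 < pw a b u := by
  unfold pw; split_ifs <;> positivity

lemma pw_meas (a b : ℝ) : Measurable (pw a b) := by
  unfold pw
  exact Measurable.ite measurableSet_Iic (by fun_prop) (by fun_prop)

lemma pw_mul (a b c d : ℝ) {u : ℝ} (hu : 0 < u) :
    pw a b u * pw c d u = pw (a + c) (b + d) u := by
  unfold pw; split_ifs <;> rw [Real.rpow_add hu]

lemma pw_pw (a b c d : ℝ) (hc : 0 ≤ c) (hd : 0 < d) {u : ℝ} (hu : 0 < u) :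
    pw a b (pw c d u) = pw (c * a) (d * b) u := by
  unfold pw
  by_cases h : u ≤ 1
  · simp only [h, if_true]
    rw [if_pos (Real.rpow_le_one hu.le h hc), Real.rpow_mul hu.le]
  · simp only [h, if_false]
    rw [if_neg (not_le.2 (Real.one_lt_rpow (not_le.1 h) hd)), Real.rpow_mul hu.le]

lemma pw_inv {u : ℝ} (hu : 0 < u) : pw (-1) (-1) u = u⁻¹ := by
  unfold pw; simp [Real.rpow_neg_one]

lemma pw_lint (a b : ℝ) (ha : -1 < a) (hb : b < -1) :
    ∫⁻ u in Ioi (0:ℝ), ENNReal.ofReal (pw a b u) < ⊤ := by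
  have hU : Ioi (0:ℝ) = Ioc 0 1 ∪ Ioi 1 := (Ioc_union_Ioi_eq_Ioi zero_le_one).symm
  have h : IntegrableOn (pw a b) (Ioi 0) := by
    rw [hU]
    refine IntegrableOn.union ?_ ?_
    · have := (intervalIntegral.intervalIntegrable_rpow' (a := 0) (b := 1) ha)
      rw [intervalIntegrable_iff_integrableOn_Ioc_of_le zero_le_one] at this
      refine this.congr_fun (fun u hu => ?_) measurableSet_Ioc
      simp [pw, hu.2]
    · refine (integrableOn_Ioi_rpow_of_lt hb one_pos).congr_fun (fun u hu => ?_) measurableSet_Ioi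
      simp [pw, not_le.2 (mem_Ioi.1 hu)]
  exact h.lintegral_lt_top

lemma lint_scale (h : ℝ → ENNReal) {t : ℝ} (ht : 0 < t) :
    ∫⁻ s in Ioi (0:ℝ), h s = ENNReal.ofReal t * ∫⁻ u in Ioi (0:ℝ), h (t * u) := by
  have := lintegral_image_eq_lintegral_abs_deriv_mul (s := Ioi (0:ℝ)) (f := fun u => t * u)
    (f' := fun _ => t) measurableSet_Ioi
    (fun x _ => by simpa using ((hasDerivAt_id x).const_mul t).hasDerivWithinAt)
    (fun x _ y _ hxy => mul_left_cancel₀ ht.ne' hxy) h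
  rw [image_mul_left_Ioi ht, mul_zero, abs_of_pos ht] at this
  rw [this, lintegral_const_mul' _ _ ENNReal.ofReal_ne_top]

section
variable {Φ : ℝ → ℝ} (hΦ : IsOrliczFunction Φ)
include hΦ

lemma phi_nonneg {x : ℝ} (hx : 0 ≤ x) : 0 ≤ Φ x := by
  rw [← hΦ.map_zero]; exact hΦ.monotoneOn (by simp) hx hx

lemma phi_cont : Continuous fun x => Φ |x| :=
  hΦ.continuousOn.comp_continuous continuous_abs fun x => abs_nonneg x

lemma phi_conv {t x : ℝ} (ht : 0 ≤ t) (ht1 : t ≤ 1) (hx : 0 ≤ x) : Φ (t * x) ≤ t * Φ x := by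
  have := hΦ.convexOn.2 (show (0:ℝ) ∈ Ici 0 by simp) (show x ∈ Ici 0 from hx)
    (sub_nonneg.2 ht1) ht (by ring)
  simpa [hΦ.map_zero] using this

lemma phi_bdd {t : ℝ} (h : orliczM Φ t ≠ 0) {s : ℝ} (hs : 0 < s) (hp : 0 < Φ s) :
    Φ (t * s) ≤ orliczM Φ t * Φ s := by
  have hb : BddAbove {r : ℝ | ∃ s : ℝ, 0 < s ∧ r = Φ (t * s) / Φ s} := by
    by_contra hb
    exact h (Real.sSup_of_not_bddAbove hb)
  rw [← div_le_iff₀ hp]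
  exact le_csSup hb ⟨s, hs, rfl⟩

lemma orM_nonneg {t : ℝ} (ht : 0 ≤ t) : 0 ≤ orliczM Φ t := by
  apply Real.sSup_nonneg
  rintro r ⟨s, hs, rfl⟩
  exact div_nonneg (phi_nonneg hΦ (by positivity)) (phi_nonneg hΦ hs.le)

lemma phi_pos {t : ℝ} (ht : 1 < t) (h : orliczM Φ t ≠ 0) {x : ℝ} (hx : 0 < x) : 0 < Φ x := by
  by_contra hcon
  have hx0 : Φ x = 0 := le_antisymm (not_lt.1 hcon) (phi_nonneg hΦ hx.le)
  obtain ⟨B, hB⟩ := (hΦ.tendsto_atTop.eventually_gt_atTop 0).exists_forall_of_atTop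
  let Z : Set ℝ := Ici 0 ∩ Φ ⁻¹' {0}
  have hZc : IsClosed Z := hΦ.continuousOn.preimage_isClosed_of_isClosed isClosed_Ici isClosed_singleton
  have hZb : BddAbove Z := ⟨B, fun y hy => by
    by_contra hlt
    have := hB y (not_le.1 hlt).le
    have h2 : Φ y = 0 := hy.2
    linarith⟩
  have hxZ : x ∈ Z := ⟨hx.le, hx0⟩
  have haZ := hZc.csSup_mem ⟨x, hxZ⟩ hZb
  set a := sSup Z
  have hxa : x ≤ a := le_csSup hZb hxZ
  have ha : 0 < a := hx.trans_le hxa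
  have hpos : ∀ y, a < y → 0 < Φ y := fun y hy => by
    rcases (phi_nonneg hΦ (ha.trans hy).le).lt_or_eq with h | h
    · exact h
    · exact absurd (le_csSup hZb ⟨(ha.trans hy).le, h.symm⟩) (not_le.2 hy)
  have hta : 0 < Φ (t * a) := hpos _ (by nlinarith)
  have hle : ∀ s, a < s → Φ (t * a) ≤ orliczM Φ t * Φ s := fun s hs =>
    (hΦ.monotoneOn (show (0:ℝ) ≤ t * a by positivity)
      (show (0:ℝ) ≤ t * s by have := ha.trans hs; positivity)
      (by gcongr)).trans (phi_bdd hΦ h (ha.trans hs) (hpos s hs))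
  have hlim : Tendsto (fun s => orliczM Φ t * Φ s) (nhdsWithin a (Ioi a)) (nhds (orliczM Φ t * Φ a)) := by
    refine Tendsto.const_mul _ ?_
    exact (hΦ.continuousOn a ha.le).mono_left (nhdsWithin_mono _ (fun y hy => (ha.trans hy).le))
  have := ge_of_tendsto hlim (eventually_nhdsWithin_of_forall hle)
  rw [show Φ a = 0 from haZ.2] at this
  linarith

lemma growth {pΦ qΦ : ℝ} (hMO : HasMatuzewskaOrliczIndices Φ pΦ qΦ) {p' q' : ℝ}
    (hp0 : 0 < p') (hp' : p' < pΦ) (hpq : 0 < qΦ) (hq' : qΦ < q') :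
    (∀ x, 0 < x → 0 < Φ x) ∧
    ∃ K, 0 < K ∧ ∀ u, 0 < u → ∀ x, 0 ≤ x → Φ (u * x) ≤ K * pw p' q' u * Φ x := by
  obtain ⟨h0, h1⟩ := hMO
  have e1 := ((h1.eventually (Ioo_mem_nhds hpq hq')).and (eventually_gt_atTop 1))
  obtain ⟨T, hT⟩ := e1.exists_forall_of_atTop
  have hM : ∀ t, T ≤ t → orliczM Φ t ≠ 0 := by
    intro t ht h
    have := (hT t ht).1.1
    simp [h] at this
  have hT1 : 1 < T := (hT T le_rfl).2
  have hpos : ∀ x, 0 < x → 0 < Φ x := fun x hx => phi_pos hΦ hT1 (hM T le_rfl) hx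
  have big : ∀ t, T ≤ t → ∀ x, 0 ≤ x → Φ (t * x) ≤ t ^ q' * Φ x := by
    intro t ht x hx
    rcases hx.eq_or_lt with rfl | hx
    · simp [hΦ.map_zero]
    have ht1 : 1 < t := (hT t ht).2
    have hMp : 0 < orliczM Φ t := lt_of_le_of_ne (orM_nonneg hΦ (by linarith)) (hM t ht).symm
    refine (phi_bdd hΦ (hM t ht) hx (hpos x hx)).trans ?_
    refine mul_le_mul_of_nonneg_right ?_ (hpos x hx).le
    have := (hT t ht).1.2
    rw [div_lt_iff₀ (Real.log_pos ht1), ← Real.log_rpow (by linarith)] at this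
    exact ((Real.log_lt_log_iff hMp (by positivity)).1 this).le
  have e0 := h0.eventually (lt_mem_nhds hp')
  rw [eventually_nhdsWithin_iff, Metric.eventually_nhds_iff] at e0
  obtain ⟨ε', hε', he⟩ := e0
  obtain ⟨ε, hε, hεm⟩ := exists_between (lt_min hε' one_pos)
  have hε1 : ε < 1 := hεm.trans_le (min_le_right _ _)
  have small : ∀ t, 0 < t → t ≤ ε → ∀ x, 0 ≤ x → Φ (t * x) ≤ t ^ p' * Φ x := by
    intro t ht0 ht x hx
    rcases hx.eq_or_lt with rfl | hx
    · simp [hΦ.map_zero]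
    have hr := he (y := t) (by
      rw [Real.dist_eq, sub_zero, abs_of_pos ht0]; exact ht.trans_lt (hεm.trans_le (min_le_left _ _))) ht0
    have ht1 : t < 1 := by linarith
    have hM0 : orliczM Φ t ≠ 0 := by
      intro h; simp [h] at hr; linarith
    have hMp : 0 < orliczM Φ t := lt_of_le_of_ne (orM_nonneg hΦ (by linarith)) hM0.symm
    refine (phi_bdd hΦ hM0 hx (hpos x hx)).trans ?_
    refine mul_le_mul_of_nonneg_right ?_ (hpos x hx).le
    rw [lt_div_iff_of_neg (Real.log_neg ht0 ht1), ← Real.log_rpow (by linarith)] at hr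
    exact ((Real.log_lt_log_iff hMp (by positivity)).1 hr).le
  refine ⟨hpos, max (T ^ q') ((1/ε) ^ p'), by positivity, ?_⟩
  intro u hu x hx
  have hq0 : 0 < q' := hpq.trans hq'
  have hK1 : 1 ≤ max (T ^ q') ((1/ε) ^ p') := le_max_of_le_left (Real.one_le_rpow hT1.le hq0.le)
  have hφ := phi_nonneg hΦ hx
  unfold pw
  split_ifs with h
  · rcases le_total u ε with hue | hue
    · refine (small u hu hue x hx).trans (mul_le_mul_of_nonneg_right ?_ hφ)
      exact le_mul_of_one_le_left (by positivity) hK1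
    · have : Φ (u * x) ≤ 1 * Φ x := by
        rw [one_mul]
        exact hΦ.monotoneOn (show (0:ℝ) ≤ u * x by positivity) hx (mul_le_of_le_one_left hx h)
      refine this.trans (mul_le_mul_of_nonneg_right ?_ hφ)
      calc 1 ≤ (1/ε * u) ^ p' := Real.one_le_rpow (by
            rw [one_div, inv_mul_eq_div, le_div_iff₀ hε]; linarith) hp0.le
        _ = (1/ε) ^ p' * u ^ p' := Real.mul_rpow (by positivity) hu.le
        _ ≤ _ := by gcongr; exact le_max_right _ _
  · push Not at h
    have hu1 : 1 ≤ u ^ q' := Real.one_le_rpow h.le hq0.le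
    rcases le_total u T with hue | hue
    · have : Φ (u * x) ≤ T ^ q' * Φ x := (hΦ.monotoneOn (show (0:ℝ) ≤ u * x by positivity)
        (show (0:ℝ) ≤ T * x by positivity) (by gcongr)).trans (big T le_rfl x hx)
      refine this.trans (mul_le_mul_of_nonneg_right ?_ hφ)
      exact (le_max_left _ _).trans (le_mul_of_one_le_right (by positivity) hu1)
    · refine (big u hue x hx).trans (mul_le_mul_of_nonneg_right ?_ hφ)
      exact le_mul_of_one_le_left (by positivity) hK1

lemma jensen (hpos : ∀ x, 0 < x → 0 < Φ x) {μ : Measure ℝ} [IsProbabilityMeasure μ] {g : ℝ → ℝ}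
    (hg : Measurable g) {y : ℝ} (hy : 0 ≤ y) (h : ENNReal.ofReal y ≤ ∫⁻ u, ENNReal.ofReal |g u| ∂μ) :
    ENNReal.ofReal (Φ y) ≤ ∫⁻ u, ENNReal.ofReal (Φ |g u|) ∂μ := by
  by_cases hfin : ∫⁻ u, ENNReal.ofReal (Φ |g u|) ∂μ = ⊤
  · rw [hfin]; exact le_top
  have hm : Measurable fun u => Φ |g u| := (phi_cont hΦ).measurable.comp hg
  have hnn : ∀ u, 0 ≤ Φ |g u| := fun u => phi_nonneg hΦ (abs_nonneg _)
  have hi : Integrable (fun u => Φ |g u|) μ :=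
    (lintegral_ofReal_ne_top_iff_integrable hm.aestronglyMeasurable (ae_of_all _ hnn)).1 hfin
  have hΦ1 := hpos 1 one_pos
  have hlin : ∀ x, 0 ≤ x → x ≤ 1 + (Φ 1)⁻¹ * Φ x := by
    intro x hx
    rcases le_total x 1 with h1 | h1
    · have := phi_nonneg hΦ hx
      have : 0 ≤ (Φ 1)⁻¹ * Φ x := by positivity
      linarith
    · have hx0 : 0 < x := by linarith
      have := phi_conv hΦ (t := x⁻¹) (x := x) (by positivity) (inv_le_one_of_one_le₀ h1) hx
      rw [inv_mul_cancel₀ hx0.ne', inv_mul_eq_div, le_div_iff₀ hx0] at this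
      have h2 : x ≤ (Φ 1)⁻¹ * Φ x := by
        rw [inv_mul_eq_div, le_div_iff₀ hΦ1]; linarith
      linarith
  have hgi : Integrable (fun u => |g u|) μ := by
    refine Integrable.mono' ((integrable_const (1:ℝ)).add (hi.const_mul (Φ 1)⁻¹))
      hg.abs.aestronglyMeasurable (ae_of_all _ fun u => ?_)
    simpa using hlin _ (abs_nonneg (g u))
  have hJ := hΦ.convexOn.map_integral_le hΦ.continuousOn isClosed_Ici
    (ae_of_all μ fun u => abs_nonneg (g u)) hgi hi
  rw [← ofReal_integral_eq_lintegral_ofReal hgi (ae_of_all _ fun u => abs_nonneg _)] at h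
  have h0 : 0 ≤ ∫ u, |g u| ∂μ := integral_nonneg fun u => abs_nonneg _
  have h' : y ≤ ∫ u, |g u| ∂μ := (ENNReal.ofReal_le_ofReal_iff h0).1 h
  rw [← ofReal_integral_eq_lintegral_ofReal hi (ae_of_all _ hnn)]
  exact ENNReal.ofReal_le_ofReal ((hΦ.monotoneOn hy h0 h').trans hJ)

end

lemma spq_bound (p q : ℝ) (f : ℝ → ℝ) {t : ℝ} (ht : 0 < t) :
    ENNReal.ofReal |Spq p q f t| ≤
      ∫⁻ u in Ioi (0:ℝ), ENNReal.ofReal (pw (1/p-1) (1/q-1) u * |f (t * u)|) := by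
  have key : ∀ r : ℝ, ∀ s, 0 < s → t ^ (-(1/r)) * (s ^ (1/r) * |f s| / s)
      = t⁻¹ * ((t⁻¹ * s) ^ (1/r-1) * |f s|) := by
    intro r s hs
    rw [Real.mul_rpow (by positivity) hs.le, Real.inv_rpow ht.le, Real.rpow_sub ht,
      Real.rpow_sub hs, Real.rpow_neg ht.le, Real.rpow_one, Real.rpow_one]
    have := Real.rpow_pos_of_pos ht (1/r)
    field_simp
  have part : ∀ r : ℝ, ∀ S : Set ℝ, MeasurableSet S → S ⊆ Ioi 0 →
      ENNReal.ofReal |t ^ (-(1/r)) * ∫ s in S, s ^ (1/r) * f s / s| ≤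
      ∫⁻ s in S, ENNReal.ofReal (t⁻¹ * ((t⁻¹ * s) ^ (1/r-1) * |f s|)) := by
    intro r S hS hS0
    rw [← integral_const_mul]
    rw [← Real.norm_eq_abs, ofReal_norm]
    refine (enorm_integral_le_lintegral_enorm _).trans (le_of_eq ?_)
    refine setLIntegral_congr_fun hS fun s hs => ?_
    have hs0 : 0 < s := hS0 hs
    rw [← key r s hs0, ← ofReal_norm, Real.norm_eq_abs, abs_mul, abs_div, abs_mul,
      abs_of_pos (Real.rpow_pos_of_pos ht _), abs_of_pos (Real.rpow_pos_of_pos hs0 _),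
      abs_of_pos hs0]
  have hR : ∫⁻ u in Ioi (0:ℝ), ENNReal.ofReal (pw (1/p-1) (1/q-1) u * |f (t * u)|)
      = ∫⁻ s in Ioi (0:ℝ), ENNReal.ofReal (t⁻¹ * (pw (1/p-1) (1/q-1) (t⁻¹ * s) * |f s|)) := by
    rw [lint_scale (fun s => ENNReal.ofReal (t⁻¹ * (pw (1/p-1) (1/q-1) (t⁻¹ * s) * |f s|))) ht,
      ← lintegral_const_mul' _ _ ENNReal.ofReal_ne_top]
    refine lintegral_congr fun u => ?_
    rw [← ENNReal.ofReal_mul ht.le]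
    congr 1
    rw [inv_mul_cancel_left₀ ht.ne']
    field_simp
  rw [hR, ← Ioc_union_Ioi_eq_Ioi ht.le, lintegral_union measurableSet_Ioi
    (Set.disjoint_left.2 fun x hx hx' => not_lt.2 hx.2 hx')]
  unfold Spq
  rw [intervalIntegral.integral_of_le ht.le]
  refine (ENNReal.ofReal_le_ofReal (abs_add_le _ _)).trans (ENNReal.ofReal_add_le.trans ?_)
  refine add_le_add ((part p _ measurableSet_Ioc fun x hx => hx.1).trans (le_of_eq ?_))
    ((part q _ measurableSet_Ioi fun x hx => ht.trans hx).trans (le_of_eq ?_))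
  · refine setLIntegral_congr_fun measurableSet_Ioc fun s hs => ?_
    have : t⁻¹ * s ≤ 1 := by rw [inv_mul_eq_div, div_le_one ht]; exact hs.2
    simp [pw, this]
  · refine setLIntegral_congr_fun measurableSet_Ioi fun s hs => ?_
    have : ¬ t⁻¹ * s ≤ 1 := by rw [inv_mul_eq_div, div_le_one ht]; exact not_le.2 hs
    simp only [pw, this, if_false]

/-- Φ-moment boundedness of the Calderón operator `S_{p,q}`
when `1 ≤ p < p_Φ ≤ q_Φ < q < ∞`. -/
theorem statement5 (Φ : ℝ → ℝ) (hΦ : IsOrliczFunction Φ) (pΦ qΦ : ℝ)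
    (hMO : HasMatuzewskaOrliczIndices Φ pΦ qΦ) (p q : ℝ)
    (hp : 1 ≤ p) (hppΦ : p < pΦ) (hpΦqΦ : pΦ ≤ qΦ) (hqΦq : qΦ < q) :
    ∃ C : ℝ, 0 < C ∧ ∀ f : ℝ → ℝ, Measurable f →
      (∫⁻ t in Set.Ioi (0:ℝ), ENNReal.ofReal (Φ |f t|)) < ⊤ →
      (∫⁻ t in Set.Ioi (0:ℝ), ENNReal.ofReal (Φ |Spq p q f t|)) ≤
        ENNReal.ofReal C * ∫⁻ t in Set.Ioi (0:ℝ), ENNReal.ofReal (Φ |f t|) := by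
  obtain ⟨p', hp1, hp2⟩ := exists_between hppΦ
  obtain ⟨q', hq1, hq2⟩ := exists_between hqΦq
  obtain ⟨hpos, K, hK, hgr⟩ := growth hΦ hMO (p' := p') (q' := q') (by linarith) hp2
    (by linarith) hq1
  have hp0 : 0 < p := by linarith
  have hq0 : 0 < q := by linarith
  obtain ⟨δ, hδ1, hδ2⟩ : ∃ δ, (p-1)/(p*(p'-1)) < δ ∧ δ < 1/p := by
    apply exists_between
    rw [div_lt_div_iff₀ (mul_pos hp0 (by linarith)) hp0]
    nlinarith
  obtain ⟨η, hη1, hη2⟩ : ∃ η, 1/q < η ∧ η < (q-1)/(q*(q'-1)) := by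
    apply exists_between
    rw [div_lt_div_iff₀ hq0 (mul_pos hq0 (by linarith))]
    nlinarith
  have hδ0 : 0 ≤ δ := le_trans (div_nonneg (by linarith) (mul_nonneg hp0.le (by linarith))) hδ1.le
  have hη0 : 0 < η := lt_trans (by positivity) hη1
  have hδ3 : 1 - 1/p < δ * (p'-1) := by
    rw [div_lt_iff₀ (mul_pos hp0 (by linarith))] at hδ1
    rw [one_sub_div hp0.ne', div_lt_iff₀ hp0]; linarith
  have hη3 : η * (q'-1) < 1 - 1/q := by
    rw [lt_div_iff₀ (mul_pos hq0 (by linarith))] at hη2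
    rw [one_sub_div hq0.ne', lt_div_iff₀ hq0]; linarith
  -- weight
  set w := pw (1/p-1-δ) (1/q-1-η) with hw
  have hwm : Measurable w := pw_meas _ _
  have hwfin : ∫⁻ u in Ioi (0:ℝ), ENNReal.ofReal (w u) < ⊤ :=
    pw_lint _ _ (by linarith) (by linarith)
  set A' := ∫⁻ u in Ioi (0:ℝ), ENNReal.ofReal (w u) with hA'
  have hA'0 : 0 < A' := by
    rw [hA', setLIntegral_pos_iff (by fun_prop)]
    have : Ioi (0:ℝ) ⊆ Function.support (fun u => ENNReal.ofReal (w u)) ∩ Ioi 0 := fun u hu =>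
      ⟨by simpa using pw_pos _ _ hu, hu⟩
    exact lt_of_lt_of_le (by simp) (measure_mono this)
  set A := A'.toReal with hA
  have hA0 : 0 < A := ENNReal.toReal_pos hA'0.ne' hwfin.ne
  have hAA : ENNReal.ofReal A = A' := ENNReal.ofReal_toReal hwfin.ne
  let μ : Measure ℝ := (volume.restrict (Ioi 0)).withDensity (fun u => ENNReal.ofReal (A⁻¹ * w u))
  have hdm : Measurable fun u => ENNReal.ofReal (A⁻¹ * w u) := by fun_prop
  have hμ : IsProbabilityMeasure μ := ⟨by
    rw [withDensity_apply _ MeasurableSet.univ, Measure.restrict_univ]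
    simp_rw [ENNReal.ofReal_mul (inv_nonneg.2 hA0.le)]
    rw [lintegral_const_mul' _ _ ENNReal.ofReal_ne_top, ← hA', ← hAA,
      ← ENNReal.ofReal_mul (inv_nonneg.2 hA0.le), inv_mul_cancel₀ hA0.ne', ENNReal.ofReal_one]⟩
  -- constant
  let v : ℝ → ℝ := pw (1/p-1-δ + δ*p' + -1) (1/q-1-η + η*q' + -1)
  let B : ℝ := A⁻¹ * (K * (K * pw p' q' A))
  have hB : 0 < B := by have := pw_pos p' q' hA0; positivity
  let D : ENNReal := ENNReal.ofReal B * ∫⁻ u in Ioi (0:ℝ), ENNReal.ofReal (v u)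
  have hD : D < ⊤ := ENNReal.mul_lt_top ENNReal.ofReal_lt_top
    (pw_lint _ _ (by linarith) (by linarith))
  refine ⟨D.toReal + 1, by positivity, fun f hf _ => ?_⟩
  have hDC : D ≤ ENNReal.ofReal (D.toReal + 1) := by
    rw [← ENNReal.ofReal_toReal hD.ne, ENNReal.toReal_ofReal ENNReal.toReal_nonneg]
    exact ENNReal.ofReal_le_ofReal (by linarith)
  refine le_trans ?_ (mul_le_mul_left hDC _)
  have hFm : Measurable fun x => ENNReal.ofReal (Φ |f x|) :=
    ((phi_cont hΦ).measurable.comp hf).ennreal_ofReal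
  have point : ∀ t, 0 < t → ENNReal.ofReal (Φ |Spq p q f t|) ≤
      ∫⁻ u in Ioi (0:ℝ), ENNReal.ofReal (B * (pw (1/p-1-δ + δ*p') (1/q-1-η + η*q') u))
        * ENNReal.ofReal (Φ |f (t * u)|) := by
    intro t ht
    have hgm : Measurable fun u => A * pw δ η u * f (t * u) :=
      ((pw_meas δ η).const_mul A).mul (hf.comp (measurable_const_mul t))
    have habs : ∀ u, 0 < u → |A * pw δ η u * f (t * u)| = A * pw δ η u * |f (t * u)| := fun u hu => by
      have := pw_pos δ η hu
      rw [abs_mul, abs_of_pos (by positivity)]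
    have J := jensen hΦ hpos (μ := μ) hgm (abs_nonneg (Spq p q f t)) (by
      refine (spq_bound p q f ht).trans (le_of_eq ?_)
      rw [lintegral_withDensity_eq_lintegral_mul _ hdm (by fun_prop)]
      refine setLIntegral_congr_fun measurableSet_Ioi fun u hu => ?_
      have hu' : 0 < u := hu
      have hwp : 0 < w u := pw_pos _ _ hu'
      simp only [Pi.mul_apply]
      rw [habs u hu', ← ENNReal.ofReal_mul (by positivity)]
      congr 1
      have := pw_mul (1/p-1-δ) (1/q-1-η) δ η hu'
      rw [sub_add_cancel, sub_add_cancel] at this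
      rw [← this, ← hw]
      field_simp)
    refine J.trans ?_
    have hgm2 : Measurable fun u => ENNReal.ofReal (Φ |A * pw δ η u * f (t * u)|) :=
      ((phi_cont hΦ).measurable.comp hgm).ennreal_ofReal
    rw [lintegral_withDensity_eq_lintegral_mul _ hdm hgm2]
    refine setLIntegral_mono' measurableSet_Ioi fun u hu => ?_
    have hu' : 0 < u := hu
    have hwp : 0 < w u := pw_pos _ _ hu'
    have hv := pw_pos (1/p-1-δ + δ*p') (1/q-1-η + η*q') hu'
    simp only [Pi.mul_apply]
    rw [habs u hu', ← ENNReal.ofReal_mul (by positivity), ← ENNReal.ofReal_mul (by positivity)]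
    apply ENNReal.ofReal_le_ofReal
    have hd := pw_pos δ η hu'
    have g1 := hgr _ hd (A * |f (t * u)|) (by positivity)
    have g2 := hgr A hA0 (|f (t * u)|) (by positivity)
    rw [pw_pw _ _ _ _ hδ0 hη0 hu'] at g1
    have hd2 := pw_pos (δ*p') (η*q') hu'
    calc A⁻¹ * w u * Φ (A * pw δ η u * |f (t * u)|)
        = A⁻¹ * w u * Φ (pw δ η u * (A * |f (t * u)|)) := by ring_nf
      _ ≤ A⁻¹ * w u * (K * pw (δ*p') (η*q') u * (K * pw p' q' A * Φ |f (t * u)|)) := by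
          refine mul_le_mul_of_nonneg_left (g1.trans ?_) (by positivity)
          exact mul_le_mul_of_nonneg_left g2 (by positivity)
      _ = _ := by
          rw [← pw_mul _ _ _ _ hu', ← hw]; simp only [B]; ring
  calc ∫⁻ t in Ioi (0:ℝ), ENNReal.ofReal (Φ |Spq p q f t|)
      ≤ ∫⁻ t in Ioi (0:ℝ), ∫⁻ u in Ioi (0:ℝ),
        ENNReal.ofReal (B * (pw (1/p-1-δ + δ*p') (1/q-1-η + η*q') u))
        * ENNReal.ofReal (Φ |f (t * u)|) := setLIntegral_mono' measurableSet_Ioi point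
    _ = ∫⁻ u in Ioi (0:ℝ), ∫⁻ t in Ioi (0:ℝ),
        ENNReal.ofReal (B * (pw (1/p-1-δ + δ*p') (1/q-1-η + η*q') u))
        * ENNReal.ofReal (Φ |f (t * u)|) := by
        apply lintegral_lintegral_swap
        apply Measurable.aemeasurable
        refine Measurable.mul (f := fun z : ℝ × ℝ =>
          ENNReal.ofReal (B * (pw (1/p-1-δ + δ*p') (1/q-1-η + η*q') z.2)))
          (g := fun z : ℝ × ℝ => ENNReal.ofReal (Φ |f (z.1 * z.2)|)) ?_ ?_
        · exact (((pw_meas _ _).comp measurable_snd).const_mul B).ennreal_ofReal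
        · exact hFm.comp (measurable_fst.mul measurable_snd)
    _ = ∫⁻ u in Ioi (0:ℝ), ENNReal.ofReal B * ENNReal.ofReal (v u) *
        ∫⁻ t in Ioi (0:ℝ), ENNReal.ofReal (Φ |f t|) := by
        refine setLIntegral_congr_fun measurableSet_Ioi fun u hu => ?_
        have hu' : 0 < u := hu
        have hv := pw_pos (1/p-1-δ + δ*p') (1/q-1-η + η*q') hu'
        rw [lintegral_const_mul' _ _ ENNReal.ofReal_ne_top,
          lint_scale (fun x => ENNReal.ofReal (Φ |f x|)) hu', ← mul_assoc,
          ← ENNReal.ofReal_mul hB.le, ← ENNReal.ofReal_mul (by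
            have : 0 < v u := pw_pos _ _ hu'
            positivity)]
        simp_rw [mul_comm u]
        congr 2
        simp only [v]
        rw [← pw_mul _ _ (-1) (-1) hu', pw_inv hu']
        field_simp
    _ = D * ∫⁻ t in Ioi (0:ℝ), ENNReal.ofReal (Φ |f t|) := by
        have hvm : Measurable fun u => ENNReal.ofReal (v u) := (pw_meas _ _).ennreal_ofReal
        rw [lintegral_mul_const _ (hvm.const_mul _), lintegral_const_mul _ hvm]
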